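/- arXiv:2108.06469 — 2 statements merged into one kernel-verified Lean document; each statement's English description precedes it below -/
import Mathlib

section
/- Let k > 0 and z > 0. (i) If z ≤ k and, for every integer j, |z − (j + 1/2)π| ≥ (π/8)/(1 + 2z/π), then [k² − (k² − z²)·(sin(2z)/(2z))] / [z²·cos²(z)] ≤ 86·max{k², 1}. (ii) For every z > 0, [k²·(sinh(2z) − 2z) + z²·sinh(2z)] / [z³·(cosh(2z) + 1)] ≤ (2/3)·k² + 1. -/
open scoped Real

lemma Real.sinh_le_mul_cosh {x : ℝ} (hx : 0 ≤ x) : Real.sinh x ≤ x * Real.cosh x := by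
  have hd (t : ℝ) : HasDerivAt (fun y : ℝ => y * Real.cosh y - Real.sinh y)
      (t * Real.sinh t) t := by
    refine (((hasDerivAt_id' t).mul (Real.hasDerivAt_cosh t)).sub
      (Real.hasDerivAt_sinh t)).congr_deriv ?_
    ring
  have hm : MonotoneOn (fun y : ℝ => y * Real.cosh y - Real.sinh y) (Set.Ici 0) := by
    refine monotoneOn_of_deriv_nonneg (convex_Ici 0)
      (fun t _ => (hd t).continuousAt.continuousWithinAt)
      (fun t _ => (hd t).differentiableAt.differentiableWithinAt) fun t ht => ?_
    rw [interior_Ici, Set.mem_Ioi] at ht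
    rw [(hd t).deriv]
    exact mul_nonneg ht.le (Real.sinh_nonneg_iff.2 ht.le)
  simpa using hm Set.self_mem_Ici hx hx

lemma Real.sinh_mul_cosh_sub_le {x : ℝ} (hx : 0 ≤ x) :
    Real.sinh x * Real.cosh x - x ≤ 2 / 3 * x ^ 3 * Real.cosh x ^ 2 := by
  have hd (t : ℝ) : HasDerivAt
      (fun y : ℝ => 2 / 3 * y ^ 3 * Real.cosh y ^ 2 - (Real.sinh y * Real.cosh y - y))
      (2 * t ^ 2 * Real.cosh t ^ 2 - 2 * Real.sinh t ^ 2
        + 4 / 3 * t ^ 3 * (Real.cosh t * Real.sinh t)) t := by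
    refine ((((hasDerivAt_pow 3 t).const_mul (2 / 3)).mul
      ((Real.hasDerivAt_cosh t).pow 2)).sub
      (((Real.hasDerivAt_sinh t).mul (Real.hasDerivAt_cosh t)).sub (hasDerivAt_id' t))).congr_deriv ?_
    simp only [Pi.pow_apply]
    push_cast
    linear_combination -Real.cosh_sq t
  have hm : MonotoneOn
      (fun y : ℝ => 2 / 3 * y ^ 3 * Real.cosh y ^ 2 - (Real.sinh y * Real.cosh y - y))
      (Set.Ici 0) := by
    refine monotoneOn_of_deriv_nonneg (convex_Ici 0)
      (fun t _ => (hd t).continuousAt.continuousWithinAt)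
      (fun t _ => (hd t).differentiableAt.differentiableWithinAt) fun t ht => ?_
    rw [interior_Ici, Set.mem_Ioi] at ht
    rw [(hd t).deriv]
    have hs : 0 ≤ Real.sinh t := Real.sinh_nonneg_iff.2 ht.le
    have hc : 0 < Real.cosh t := Real.cosh_pos t
    have hsq := pow_le_pow_left₀ hs (Real.sinh_le_mul_cosh ht.le) 2
    have : 0 ≤ 4 / 3 * t ^ 3 * (Real.cosh t * Real.sinh t) := by positivity
    linarith [mul_pow t (Real.cosh t) 2]
  simpa using hm Set.self_mem_Ici hx hx

lemma Real.exists_int_two_div_pi_mul_abs_le_abs_cos (x : ℝ) :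
    ∃ j : ℤ, 2 / π * |x - ((j : ℝ) + 1 / 2) * π| ≤ |Real.cos x| := by
  refine ⟨⌊x / π⌋, ?_⟩
  have h1 := (le_div_iff₀ Real.pi_pos).1 (Int.floor_le (x / π))
  have h2 := (div_lt_iff₀ Real.pi_pos).1 (Int.lt_floor_add_one (x / π))
  have h3 : |x - ((⌊x / π⌋ : ℝ) + 1 / 2) * π| ≤ π / 2 := abs_le.2 ⟨by linarith, by linarith⟩
  refine (Real.mul_abs_le_abs_sin h3).trans_eq ?_
  rw [show x - ((⌊x / π⌋ : ℝ) + 1 / 2) * π = x - ⌊x / π⌋ * π - π / 2 by ring,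
    Real.sin_sub_pi_div_two, abs_neg, Real.cos_sub_int_mul_pi, abs_mul, abs_zpow, abs_neg,
    abs_one, one_zpow, one_mul]

/-- Bound on the propagating mode quotient in the regime `z ≤ 1`, where no separation from the
zeros of the cosine is needed. -/
lemma propagating_bound_of_le_one {k z : ℝ} (hz : 0 < z) (hz1 : z ≤ 1) (hzk : z ≤ k) :
    k ^ 2 - (k ^ 2 - z ^ 2) * (Real.sin (2 * z) / (2 * z))
      ≤ 86 * max (k ^ 2) 1 * (z ^ 2 * Real.cos z ^ 2) := by
  have hsin := (Real.sin_gt_sub_cube hz).le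
  have hcos : 1 - z ^ 2 / 2 ≤ Real.cos z := Real.one_sub_sq_div_two_le_cos
  have hz2 : z ^ 2 ≤ 1 := pow_le_one₀ hz.le hz1
  have hs : 1 - 3 / 4 * z ^ 2 ≤ Real.sin (2 * z) / (2 * z) := by
    rw [le_div_iff₀ (by positivity), Real.sin_two_mul]
    have := mul_le_mul hsin hcos (by linarith) (Real.sin_nonneg_of_nonneg_of_le_pi hz.le
      (by linarith [Real.pi_gt_three]))
    nlinarith [pow_pos hz 5]
  have hkz : 0 ≤ k ^ 2 - z ^ 2 := sub_nonneg.2 (pow_le_pow_left₀ hz.le hzk 2)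
  have hc2 : 1 / 4 ≤ Real.cos z ^ 2 := by nlinarith
  have hN := mul_le_mul_of_nonneg_left hs hkz
  have hM1 := le_max_left (k ^ 2) 1
  have hM2 := le_max_right (k ^ 2) 1
  set M := max (k ^ 2) 1
  calc _ ≤ (3 / 4 * k ^ 2 + 1) * z ^ 2 := by nlinarith [sq_nonneg (z ^ 2)]
    _ ≤ (86 * M * (1 / 4)) * z ^ 2 := by gcongr; linarith
    _ ≤ (86 * M * Real.cos z ^ 2) * z ^ 2 := by gcongr
    _ = _ := by ring

/-- Bound on the propagating mode quotient in the regime `1 ≤ z`, where `z` is kept away from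
the zeros of the cosine. -/
lemma propagating_bound_of_one_le {k z : ℝ} (hz1 : 1 ≤ z) (hzk : z ≤ k)
    (hsep : ∀ j : ℤ, |z - ((j : ℝ) + 1 / 2) * π| ≥ (π / 8) / (1 + 2 * z / π)) :
    k ^ 2 - (k ^ 2 - z ^ 2) * (Real.sin (2 * z) / (2 * z))
      ≤ 86 * max (k ^ 2) 1 * (z ^ 2 * Real.cos z ^ 2) := by
  have hz : 0 < z := by linarith
  have hπ := Real.pi_gt_three
  obtain ⟨j, hj⟩ := Real.exists_int_two_div_pi_mul_abs_le_abs_cos z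
  have hcos : 3 / 20 ≤ z * |Real.cos z| := by
    have h1 : 2 * z / π ≤ 2 / 3 * z := by
      rw [div_le_iff₀ Real.pi_pos]; nlinarith
    calc (3 / 20 : ℝ) ≤ z * (1 / 4 / (1 + 2 * z / π)) := by
          rw [← mul_div_assoc, le_div_iff₀ (by positivity)]; linarith
      _ = z * (2 / π * ((π / 8) / (1 + 2 * z / π))) := by field_simp; norm_num
      _ ≤ z * (2 / π * |z - ((j : ℝ) + 1 / 2) * π|) := by gcongr; exact hsep j
      _ ≤ z * |Real.cos z| := by gcongr
  have hc2 : 9 / 400 ≤ z ^ 2 * Real.cos z ^ 2 := by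
    have := pow_le_pow_left₀ (by norm_num) hcos 2
    rw [mul_pow, sq_abs] at this
    linarith
  have hs : -(1 / 2) ≤ Real.sin (2 * z) / (2 * z) := by
    rw [le_div_iff₀ (by positivity)]
    linarith [Real.neg_one_le_sin (2 * z)]
  have hkz : 0 ≤ k ^ 2 - z ^ 2 := sub_nonneg.2 (pow_le_pow_left₀ hz.le hzk 2)
  have hN := mul_le_mul_of_nonneg_left hs hkz
  calc _ ≤ 86 * k ^ 2 * (9 / 400) := by nlinarith
    _ ≤ _ := by gcongr; exact le_max_left _ _

/-- Per-mode bounds `φ̃ₙ ≤ 86·max{k²,1}` (propagating) and `ψ̃ₙ ≤ (2/3)k² + 1`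
(evanescent) for the lifting with Neumann datum on the bottom side and homogeneous
Dirichlet condition on the top side. -/
theorem stmt_14 (k z : ℝ) (hk : 0 < k) (hz : 0 < z) :
    ((z ≤ k ∧ ∀ j : ℤ, |z - ((j : ℝ) + 1 / 2) * π| ≥ (π / 8) / (1 + 2 * z / π)) →
      (k ^ 2 - (k ^ 2 - z ^ 2) * (Real.sin (2 * z) / (2 * z)))
        / (z ^ 2 * Real.cos z ^ 2)
      ≤ 86 * max (k ^ 2) 1)
    ∧ ((k ^ 2 * (Real.sinh (2 * z) - 2 * z) + z ^ 2 * Real.sinh (2 * z))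
        / (z ^ 3 * (Real.cosh (2 * z) + 1))
      ≤ (2 / 3) * k ^ 2 + 1) := by
  constructor
  · rintro ⟨hzk, hsep⟩
    refine div_le_of_le_mul₀ (by positivity) (by positivity) ?_
    rcases le_total z 1 with h | h
    · exact propagating_bound_of_le_one hz h hzk
    · exact propagating_bound_of_one_le h hzk hsep
  · have hC := Real.cosh_pos z
    have hcosh : Real.cosh (2 * z) + 1 = 2 * Real.cosh z ^ 2 := by
      rw [Real.cosh_two_mul, Real.sinh_sq]; ring
    rw [hcosh, Real.sinh_two_mul, div_le_iff₀ (by positivity)]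
    have h1 := mul_le_mul_of_nonneg_left (Real.sinh_mul_cosh_sub_le hz.le) (sq_nonneg k)
    have h2 := mul_le_mul_of_nonneg_left (Real.sinh_le_mul_cosh hz.le)
      (by positivity : 0 ≤ z ^ 2 * Real.cosh z)
    linarith
end

section
/- Let n be a positive integer and set k := √(n²π² + π²/4). Define ũ : [0,1]² → ℝ by ũ(x,y) = −(2/π)·√2·cos(nπx)·cos((π/2)(y − 1)). Then: (i) Δũ(x,y) + k²·ũ(x,y) = 0 for all (x,y) ∈ (0,1)²; (ii) −∂_yũ(x,0) = √2·cos(nπx) for all x ∈ [0,1]; (iii) ∂_yũ(x,1) = 0 for all x ∈ [0,1]; and (iv) ‖∇ũ‖_{0,Ω} + k·‖ũ‖_{0,Ω} = (2√2/π)·k, where Ω = (0,1)², ‖v‖_{0,Ω} := (∫_Ω |v|²)^{1/2} and ‖∇ũ‖_{0,Ω} := (∫_Ω |∂ₓũ|² + |∂_y ũ|²)^{1/2}. -/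
open scoped Real

/-- The mean of `cos ^ 2` over finitely many quarter-periods. -/
theorem integral_cos_mul_sq_of_sin_mul_cos_eq_zero {a : ℝ} (ha : a ≠ 0)
    (h : Real.sin a * Real.cos a = 0) :
    ∫ x in (0 : ℝ)..1, Real.cos (a * x) ^ 2 = 1 / 2 := by
  rw [intervalIntegral.integral_comp_mul_left (fun x => Real.cos x ^ 2) ha, integral_cos_sq]
  simp only [mul_one, mul_zero, Real.sin_zero, mul_comm (Real.cos a), h, smul_eq_mul]
  field_simp
  ring

/-- The mean of `sin ^ 2` over finitely many quarter-periods. -/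
theorem integral_sin_mul_sq_of_sin_mul_cos_eq_zero {a : ℝ} (ha : a ≠ 0)
    (h : Real.sin a * Real.cos a = 0) :
    ∫ x in (0 : ℝ)..1, Real.sin (a * x) ^ 2 = 1 / 2 := by
  rw [intervalIntegral.integral_comp_mul_left (fun x => Real.sin x ^ 2) ha, integral_sin_sq]
  simp only [mul_one, mul_zero, Real.sin_zero, h, smul_eq_mul]
  field_simp
  ring

theorem deriv_const_mul_cos_mul (c a x : ℝ) :
    deriv (fun s => c * Real.cos (a * s)) x = -(c * a) * Real.sin (a * x) := by
  have h := (((hasDerivAt_id x).const_mul a).cos).const_mul c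
  simp only [id, mul_one] at h
  rw [h.deriv]
  ring

theorem deriv_const_mul_sin_mul (c a x : ℝ) :
    deriv (fun s => c * Real.sin (a * s)) x = c * a * Real.cos (a * x) := by
  have h := (((hasDerivAt_id x).const_mul a).sin).const_mul c
  simp only [id, mul_one] at h
  rw [h.deriv]
  ring

/-- A double integral over the unit square of a sum of two separated functions. -/
theorem integral_unit_square_add_mul {f g p q : ℝ → ℝ} (c d : ℝ) (hf : Continuous f)
    (hg : Continuous g) (hp : Continuous p) (hq : Continuous q) :
    ∫ x in (0 : ℝ)..1, ∫ y in (0 : ℝ)..1, c * f x * p y + d * g x * q y =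
      c * (∫ x in (0 : ℝ)..1, f x) * (∫ y in (0 : ℝ)..1, p y) +
        d * (∫ x in (0 : ℝ)..1, g x) * ∫ y in (0 : ℝ)..1, q y := by
  have inner (x : ℝ) : ∫ y in (0 : ℝ)..1, c * f x * p y + d * g x * q y =
      c * f x * (∫ y in (0 : ℝ)..1, p y) + d * g x * ∫ y in (0 : ℝ)..1, q y := by
    rw [intervalIntegral.integral_add, intervalIntegral.integral_const_mul,
      intervalIntegral.integral_const_mul] <;>
      exact Continuous.intervalIntegrable (by fun_prop) _ _
  simp only [inner]
  rw [intervalIntegral.integral_add, intervalIntegral.integral_mul_const,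
    intervalIntegral.integral_mul_const, intervalIntegral.integral_const_mul,
    intervalIntegral.integral_const_mul] <;>
    exact Continuous.intervalIntegrable (by fun_prop) _ _

/-- Sharpness example for the lifting stability bound with Neumann data: the explicit
auxiliary solution `ũ(x,y) = −(2/π)·√2·cos(nπx)·cos((π/2)(y−1))` with
`k = √(n²π² + π²/4)`. -/
theorem stmt_19 (n : ℕ) (hn : 0 < n) (k : ℝ)
    (hk : k = Real.sqrt ((n : ℝ) ^ 2 * π ^ 2 + π ^ 2 / 4))
    (u : ℝ → ℝ → ℝ)
    (hu : ∀ x y : ℝ,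
      u x y = -(2 / π) * (Real.sqrt 2 * Real.cos ((n : ℝ) * π * x)) *
        Real.cos ((π / 2) * (y - 1))) :
    (∀ x ∈ Set.Ioo (0 : ℝ) 1, ∀ y ∈ Set.Ioo (0 : ℝ) 1,
      deriv (deriv fun s => u s y) x + deriv (deriv fun t => u x t) y
        + k ^ 2 * u x y = 0)
    ∧ (∀ x ∈ Set.Icc (0 : ℝ) 1,
        -(deriv (fun t => u x t) 0) = Real.sqrt 2 * Real.cos ((n : ℝ) * π * x))
    ∧ (∀ x ∈ Set.Icc (0 : ℝ) 1, deriv (fun t => u x t) 1 = 0)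
    ∧ (Real.sqrt (∫ x in (0 : ℝ)..1, ∫ y in (0 : ℝ)..1,
          (deriv (fun s => u s y) x) ^ 2 + (deriv (fun t => u x t) y) ^ 2)
        + k * Real.sqrt (∫ x in (0 : ℝ)..1, ∫ y in (0 : ℝ)..1, (u x y) ^ 2)
        = (2 * Real.sqrt 2 / π) * k) := by
  have hπ : π ≠ 0 := Real.pi_ne_zero
  have h2 : Real.sqrt 2 ^ 2 = 2 := Real.sq_sqrt (by norm_num)
  have hk2 : k ^ 2 = (n : ℝ) ^ 2 * π ^ 2 + π ^ 2 / 4 := by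
    rw [hk, Real.sq_sqrt (by positivity)]
  have hk0 : 0 ≤ k := hk ▸ Real.sqrt_nonneg _
  have u_eq (x y : ℝ) : u x y =
      -(2 / π) * Real.sqrt 2 * Real.cos (n * π * x) * Real.sin (π / 2 * y) := by
    rw [hu, ← Real.cos_pi_div_two_sub, ← Real.cos_neg (π / 2 - _)]
    ring_nf
  have deriv_x (y : ℝ) : deriv (fun s => u s y) = fun x =>
      2 * n * Real.sqrt 2 * Real.sin (π / 2 * y) * Real.sin (n * π * x) := by
    have h : (fun s => u s y) = fun s =>
        (-(2 / π) * Real.sqrt 2 * Real.sin (π / 2 * y)) * Real.cos (n * π * s) := by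
      funext s
      rw [u_eq]
      ring
    funext x
    rw [h, deriv_const_mul_cos_mul]
    field_simp
  have deriv_y (x : ℝ) : deriv (fun t => u x t) = fun y =>
      -(Real.sqrt 2 * Real.cos (n * π * x)) * Real.cos (π / 2 * y) := by
    funext y
    simp only [u_eq]
    rw [deriv_const_mul_sin_mul]
    field_simp
  have hn0 : (n : ℝ) * π ≠ 0 := by positivity
  have hnsin : Real.sin (n * π) * Real.cos (n * π) = 0 := by simp [Real.sin_nat_mul_pi]
  have hhalf : Real.sin (π / 2) * Real.cos (π / 2) = 0 := by simp
  have hπ2 : π / 2 ≠ 0 := by positivity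
  refine ⟨fun x _ y _ => ?_, fun x _ => ?_, fun x _ => ?_, ?_⟩
  · rw [deriv_x, deriv_y, deriv_const_mul_sin_mul, deriv_const_mul_cos_mul, hk2, u_eq]
    field_simp
    ring
  · simp [deriv_y]
  · simp [deriv_y]
  · have grad : ∫ x in (0 : ℝ)..1, ∫ y in (0 : ℝ)..1,
        (deriv (fun s => u s y) x) ^ 2 + (deriv (fun t => u x t) y) ^ 2 =
          (k * (Real.sqrt 2 / π)) ^ 2 := by
      have h (x y : ℝ) : (deriv (fun s => u s y) x) ^ 2 + (deriv (fun t => u x t) y) ^ 2 =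
          8 * (n : ℝ) ^ 2 * Real.sin (n * π * x) ^ 2 * Real.sin (π / 2 * y) ^ 2 +
            2 * Real.cos (n * π * x) ^ 2 * Real.cos (π / 2 * y) ^ 2 := by
        rw [deriv_x, deriv_y]
        simp only [mul_pow, neg_sq, h2]
        ring
      simp only [h]
      rw [integral_unit_square_add_mul (f := fun x => Real.sin (n * π * x) ^ 2)
        (g := fun x => Real.cos (n * π * x) ^ 2) (p := fun y => Real.sin (π / 2 * y) ^ 2)
        (q := fun y => Real.cos (π / 2 * y) ^ 2) _ _ (by fun_prop) (by fun_prop) (by fun_prop)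
        (by fun_prop), integral_sin_mul_sq_of_sin_mul_cos_eq_zero hn0 hnsin,
        integral_cos_mul_sq_of_sin_mul_cos_eq_zero hn0 hnsin,
        integral_sin_mul_sq_of_sin_mul_cos_eq_zero hπ2 hhalf,
        integral_cos_mul_sq_of_sin_mul_cos_eq_zero hπ2 hhalf, mul_pow, div_pow, h2, hk2]
      field_simp
      ring
    have mass : ∫ x in (0 : ℝ)..1, ∫ y in (0 : ℝ)..1, (u x y) ^ 2 =
        (Real.sqrt 2 / π) ^ 2 := by
      have h (x y : ℝ) : (u x y) ^ 2 =
          8 / π ^ 2 * Real.cos (n * π * x) ^ 2 * Real.sin (π / 2 * y) ^ 2 := by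
        rw [u_eq]
        simp only [mul_pow, neg_sq, div_pow, h2]
        ring
      simp only [h, intervalIntegral.integral_const_mul, intervalIntegral.integral_mul_const]
      rw [integral_cos_mul_sq_of_sin_mul_cos_eq_zero hn0 hnsin,
        integral_sin_mul_sq_of_sin_mul_cos_eq_zero hπ2 hhalf, div_pow, h2]
      field_simp
      ring
    rw [grad, mass, Real.sqrt_sq (by positivity), Real.sqrt_sq (by positivity)]
    ring
end
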